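/- Let T¹ ∈ ℝ with T¹ ≠ 0, and consider on ℝ² the connection with constant Christoffel symbols Γ_{12}¹ = T¹, Γ_{21}¹ = −T¹, Γ_{22}² = 1, and all other Γ_{ij}^k = 0 (the model M₃⁶(T¹,0)). Then a smooth vector field X on ℝ² is an affine Killing vector field for this connection if and only if X lies in the ℝ-linear span of the four vector fields (1,0), (0,1), (x¹, 0), and (e^{x²}, 0). -/

import Mathlib

open Real

/-- The partial derivative `∂f/∂x^i` of a function on `ℝ²` (points are `Fin 2 → ℝ`). -/
noncomputable def pd (f : (Fin 2 → ℝ) → ℝ) (i : Fin 2) (p : Fin 2 → ℝ) : ℝ :=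
  fderiv ℝ f p (Pi.single i 1)

/-- The affine Killing operator
`K^Γ_{ij}^k(v) = ∂_i∂_j v^k + v^l ∂_l Γ_{ij}^k − Γ_{ij}^l ∂_l v^k + Γ_{il}^k ∂_j v^l + Γ_{lj}^k ∂_i v^l`
(summation over `l`). -/
noncomputable def killingOp (Γ : Fin 2 → Fin 2 → Fin 2 → (Fin 2 → ℝ) → ℝ)
    (v : Fin 2 → (Fin 2 → ℝ) → ℝ) (i j k : Fin 2) (p : Fin 2 → ℝ) : ℝ :=
  pd (fun q => pd (v k) j q) i p
    + (∑ l : Fin 2, v l p * pd (Γ i j k) l p)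
    - (∑ l : Fin 2, Γ i j l p * pd (v k) l p)
    + (∑ l : Fin 2, Γ i l k p * pd (v l) j p)
    + (∑ l : Fin 2, Γ l j k p * pd (v l) i p)

/-- `v` is an affine Killing vector field for the connection `Γ` on `U`:
all eight affine Killing equations hold on `U`. -/
def IsAffineKilling (U : Set (Fin 2 → ℝ))
    (Γ : Fin 2 → Fin 2 → Fin 2 → (Fin 2 → ℝ) → ℝ)
    (v : Fin 2 → (Fin 2 → ℝ) → ℝ) : Prop :=
  ∀ i j k : Fin 2, ∀ p ∈ U, killingOp Γ v i j k p = 0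

theorem pd_const (c : ℝ) (i : Fin 2) (p : Fin 2 → ℝ) : pd (fun _ => c) i p = 0 := by
  simp [pd]

theorem contDiff_pd {f : (Fin 2 → ℝ) → ℝ} (hf : ContDiff ℝ (⊤ : ℕ∞) f) (i : Fin 2) :
    ContDiff ℝ (⊤ : ℕ∞) (pd f i) :=
  (hf.fderiv_right (m := (⊤ : ℕ∞)) (by simp)).clm_apply contDiff_const

theorem pd_comm {f : (Fin 2 → ℝ) → ℝ} (hf : ContDiff ℝ (⊤ : ℕ∞) f) (i j : Fin 2)
    (p : Fin 2 → ℝ) : pd (pd f j) i p = pd (pd f i) j p := by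
  have hd : DifferentiableAt ℝ (fderiv ℝ f) p :=
    ((hf.fderiv_right (m := (⊤ : ℕ∞)) (by simp)).differentiable (by simp)) p
  have key (a b : Fin 2) :
      pd (pd f b) a p = fderiv ℝ (fderiv ℝ f) p (Pi.single a 1) (Pi.single b 1) := by
    change fderiv ℝ (fun q => fderiv ℝ f q (Pi.single b 1)) p (Pi.single a 1) = _
    rw [fderiv_clm_apply hd (differentiableAt_const _)]
    simp
  have hsymm : IsSymmSndFDerivAt ℝ f p := hf.contDiffAt.isSymmSndFDerivAt
    (by simpa using WithTop.coe_le_coe.2 (le_top : (2 : ℕ∞) ≤ ⊤))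
  rw [key, key]
  exact hsymm _ _

theorem eq_of_pd_eq_zero {f : (Fin 2 → ℝ) → ℝ} (hf : Differentiable ℝ f)
    (h : ∀ i p, pd f i p = 0) (p q : Fin 2 → ℝ) : f p = f q := by
  refine is_const_of_fderiv_eq_zero hf (fun r => ?_) p q
  refine ContinuousLinearMap.coe_injective (LinearMap.pi_ext' fun i => LinearMap.ext_ring ?_)
  simpa [pd] using h i r

theorem pd_sub {f g : (Fin 2 → ℝ) → ℝ} (hf : Differentiable ℝ f) (hg : Differentiable ℝ g)
    (i : Fin 2) (p : Fin 2 → ℝ) : pd (fun q => f q - g q) i p = pd f i p - pd g i p := by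
  simp [pd, fderiv_fun_sub (hf p) (hg p)]

theorem pd_mul_exp {f : (Fin 2 → ℝ) → ℝ} (hf : Differentiable ℝ f) (c : ℝ) (i : Fin 2)
    (p : Fin 2 → ℝ) :
    pd (fun q => f q * exp (c * q 1)) i p =
      (pd f i p + c * f p * (Pi.single i 1 : Fin 2 → ℝ) 1) * exp (c * p 1) := by
  have h1 : HasFDerivAt (fun q : Fin 2 → ℝ => q 1)
      (ContinuousLinearMap.proj (R := ℝ) (φ := fun _ : Fin 2 => ℝ) 1) p :=
    hasFDerivAt_apply 1 p
  have h := (hf p).hasFDerivAt.mul (h1.const_mul c).exp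
  change fderiv ℝ (f * fun q : Fin 2 → ℝ => exp (c * q 1)) p (Pi.single i 1) = _
  rw [h.fderiv]
  simp [pd]
  ring

theorem pd_affine_add_exp (a c d : ℝ) (i : Fin 2) (p : Fin 2 → ℝ) :
    pd (fun q => a + c * q 0 + d * exp (q 1)) i p =
      c * (Pi.single i 1 : Fin 2 → ℝ) 0 + d * exp (p 1) * (Pi.single i 1 : Fin 2 → ℝ) 1 := by
  have hp (j : Fin 2) : HasFDerivAt (fun q : Fin 2 → ℝ => q j)
      (ContinuousLinearMap.proj (R := ℝ) (φ := fun _ : Fin 2 => ℝ) j) p :=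
    hasFDerivAt_apply j p
  have h := (((hp 0).const_mul c).const_add a).add ((hp 1).exp.const_mul d)
  change fderiv ℝ ((fun q : Fin 2 → ℝ => a + c * q 0) + fun q => d * exp (q 1)) p
    (Pi.single i 1) = _
  rw [h.fderiv]
  simp
  ring

/-- A smooth function with `∂₁∂₁u = ∂₁∂₂u = 0` and `∂₂∂₂u = ∂₂u` is a combination of
`1`, `x¹` and `e^{x²}`. -/
theorem exists_eq_affine_add_exp {u : (Fin 2 → ℝ) → ℝ} (hu : ContDiff ℝ (⊤ : ℕ∞) u)
    (h00 : ∀ p, pd (pd u 0) 0 p = 0) (h01 : ∀ p, pd (pd u 1) 0 p = 0)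
    (h11 : ∀ p, pd (pd u 1) 1 p = pd u 1 p) :
    ∃ a c d : ℝ, ∀ p, u p = a + c * p 0 + d * exp (p 1) := by
  have hd (i : Fin 2) : Differentiable ℝ (pd u i) := (contDiff_pd hu i).differentiable (by simp)
  have hc (p : Fin 2 → ℝ) : pd u 0 p = pd u 0 0 := by
    refine eq_of_pd_eq_zero (hd 0) (fun i q => ?_) p 0
    fin_cases i
    · exact h00 q
    · exact (pd_comm hu 1 0 q).trans (h01 q)
  have he (p : Fin 2 → ℝ) : pd u 1 p = pd u 1 0 * exp (p 1) := by
    have h : pd u 1 p * exp (-1 * p 1) = pd u 1 0 * exp (-1 * (0 : Fin 2 → ℝ) 1) := by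
      refine eq_of_pd_eq_zero (f := fun q => pd u 1 q * exp (-1 * q 1))
        ((hd 1).mul (by fun_prop)) (fun i q => ?_) p 0
      rw [pd_mul_exp (hd 1)]
      fin_cases i
      · simp [h01]
      · simp [h11]
    have h' : exp (-1 * p 1) * exp (p 1) = 1 := by rw [← exp_add]; simp
    simp only [Pi.zero_apply, mul_zero, exp_zero, mul_one] at h
    rw [← h, mul_assoc, h', mul_one]
  have hu' : Differentiable ℝ u := hu.differentiable (by simp)
  let g : (Fin 2 → ℝ) → ℝ := fun q => 0 + pd u 0 0 * q 0 + pd u 1 0 * exp (q 1)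
  have hg : Differentiable ℝ g := by fun_prop
  refine ⟨u 0 - g 0, pd u 0 0, pd u 1 0, fun p => ?_⟩
  have h : u p - g p = u 0 - g 0 := by
    refine eq_of_pd_eq_zero (hu'.sub hg) (fun i q => ?_) p 0
    refine (pd_sub hu' hg i q).trans ?_
    rw [pd_affine_add_exp]
    fin_cases i
    · simp [hc q]
    · simp [he q]
  rw [← h]
  simp only [g]
  ring

theorem stmt8 (T1 : ℝ) (hT : T1 ≠ 0)
    (v : Fin 2 → (Fin 2 → ℝ) → ℝ)
    (hv : ∀ i : Fin 2, ContDiff ℝ (⊤ : ℕ∞) (v i)) :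
    IsAffineKilling Set.univ
      (fun i j k => fun _ : Fin 2 → ℝ =>
        ![![![(0 : ℝ), 0], ![T1, 0]], ![![-T1, 0], ![0, 1]]] i j k) v
    ↔ ∃ a b c d : ℝ, ∀ p : Fin 2 → ℝ,
        v 0 p = a + c * p 0 + d * Real.exp (p 1)
        ∧ v 1 p = b := by
  have hw : Differentiable ℝ (v 1) := (hv 1).differentiable (by simp)
  constructor
  · intro h
    have H (i j k : Fin 2) (p : Fin 2 → ℝ) := h i j k p (Set.mem_univ p)
    simp only [killingOp, pd_const, Fin.sum_univ_two] at H
    have hw1 (p : Fin 2 → ℝ) : pd (v 1) 1 p = 0 := by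
      have e1 := H 0 1 0 p
      have e2 := H 1 0 0 p
      have e3 := pd_comm (hv 0) 0 1 p
      simp at e1 e2
      refine (mul_eq_zero.1 (?_ : T1 * pd (v 1) 1 p = 0)).resolve_left hT
      linarith
    have hw0 (p : Fin 2 → ℝ) : pd (v 1) 0 p = 0 := by
      have e1 := H 0 1 1 p
      have e2 := H 1 0 1 p
      have e3 := pd_comm (hv 1) 0 1 p
      simp at e1 e2
      refine (mul_eq_zero.1 (?_ : T1 * pd (v 1) 0 p = 0)).resolve_left hT
      linarith
    obtain ⟨a, c, d, hu⟩ := exists_eq_affine_add_exp (hv 0)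
      (fun p => by have e := H 0 0 0 p; simp [hw0] at e; linarith)
      (fun p => by have e := H 0 1 0 p; simp [hw1] at e; linarith)
      (fun p => by have e := H 1 1 0 p; simp at e; linarith)
    refine ⟨a, v 1 0, c, d, fun p => ⟨hu p, eq_of_pd_eq_zero hw (fun i q => ?_) p 0⟩⟩
    fin_cases i
    · exact hw0 q
    · exact hw1 q
  · rintro ⟨a, b, c, d, h⟩ i j k p -
    have hu : v 0 = fun q => a + c * q 0 + d * exp (q 1) := funext fun q => (h q).1
    have hb : v 1 = fun _ => b := funext fun q => (h q).2
    have hexp (i : Fin 2) (q : Fin 2 → ℝ) : pd (fun r => d * exp (r 1)) i q =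
        d * exp (q 1) * (Pi.single i 1 : Fin 2 → ℝ) 1 := by
      simpa using pd_affine_add_exp 0 0 d i q
    fin_cases i <;> fin_cases j <;> fin_cases k <;>
      simp [killingOp, hu, hb, pd_const, pd_affine_add_exp, hexp]
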